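/- The pointwise dimension of the Erdős measure equals Garsia's entropy: there is a real number H_μ such that H^{(n)}/n → H_μ as n → ∞, and for μ-almost every x ∈ [0,1], lim_{r→0⁺} log μ([x−r, x+r]) / log r = H_μ. -/

import Mathlib

open MeasureTheory Filter Topology
open scoped ENNReal

/-- The golden ratio λ = (1+√5)/2. -/
noncomputable def gold : ℝ := (1 + Real.sqrt 5) / 2

/-- `p` is the Bernoulli (1/2,1/2) product measure on `{0,1}^ℕ`, characterized by its
values on cylinder sets. -/
def IsCoinMeasure (p : Measure (ℕ → Bool)) : Prop :=
  ∀ (s : Finset ℕ) (b : ℕ → Bool), p {ε | ∀ i ∈ s, ε i = b i} = (2 : ℝ≥0∞)⁻¹ ^ s.card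

/-- π(ε) = Σ_{k=1}^∞ ε_k λ^{-k-1} (indices shifted so that `ε k` is `ε_{k+1}`). -/
noncomputable def piMap (ε : ℕ → Bool) : ℝ := ∑' k : ℕ, if ε k then gold⁻¹ ^ (k + 2) else 0

/-- The Erdős measure: the pushforward of the coin measure `p` under `piMap`. -/
noncomputable def erdosOf (p : Measure (ℕ → Bool)) : Measure ℝ := p.map piMap

/-- Fibonacci numbers with the convention `F 1 = 1`, `F 2 = 2`. -/
def fibF (n : ℕ) : ℕ := Nat.fib (n + 1)

/-- `countRep n k` is the number of tuples `(ε_1,…,ε_n) ∈ {0,1}^n` with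
`k = Σ_{j=1}^n ε_j F_j`. -/
def countRep (n k : ℕ) : ℕ :=
  (Finset.univ.filter fun ε : Fin n → Bool =>
    (∑ j : Fin n, if ε j then fibF (j + 1) else 0) = k).card

/-- `H⁽ⁿ⁾ = −Σ_{k=0}^{F_{n+2}−2} (f_n(k)/2ⁿ)·log_λ(f_n(k)/2ⁿ)`. -/
noncomputable def Hent (n : ℕ) : ℝ :=
  -∑ k ∈ Finset.range (fibF (n + 2) - 1),
      ((countRep n k : ℝ) / 2 ^ n) * Real.logb gold ((countRep n k : ℝ) / 2 ^ n)

/-! ### The golden ratio -/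

lemma gold_eq : gold = Real.goldenRatio := rfl

lemma one_lt_gold : 1 < gold := Real.one_lt_goldenRatio

lemma gold_pos : 0 < gold := Real.goldenRatio_pos

lemma goldenConj_eq : Real.goldenConj = -gold⁻¹ := by
  rw [gold_eq, Real.inv_goldenRatio, neg_neg]

lemma inv_gold_pos : 0 < gold⁻¹ := inv_pos.2 gold_pos

lemma inv_gold_lt_one : gold⁻¹ < 1 := inv_lt_one_of_one_lt₀ one_lt_gold

lemma inv_gold_sq : gold⁻¹ ^ 2 = 1 - gold⁻¹ := by
  have h := Real.goldenConj_sq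
  rw [goldenConj_eq] at h
  linarith

lemma sum_inv_gold_pow (n : ℕ) :
    ∑ k ∈ Finset.range n, gold⁻¹ ^ (k + 2) = 1 - gold⁻¹ ^ n := by
  induction n with
  | zero => simp
  | succ n ih =>
    rw [Finset.sum_range_succ, ih, pow_add _ _ 2, inv_gold_sq]
    ring

lemma abs_sum_goldenConj_lt {m : ℕ} (c : Fin m → ℝ) (hc : ∀ i, |c i| ≤ 1) :
    |∑ i, c i * Real.goldenConj ^ ((i : ℕ) + 2)| < 1 := by
  calc |∑ i, c i * Real.goldenConj ^ ((i : ℕ) + 2)|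
      ≤ ∑ i, |c i * Real.goldenConj ^ ((i : ℕ) + 2)| := Finset.abs_sum_le_sum_abs _ _
    _ ≤ ∑ i : Fin m, gold⁻¹ ^ ((i : ℕ) + 2) := by
        refine Finset.sum_le_sum fun i _ => ?_
        rw [abs_mul, abs_pow, goldenConj_eq, abs_neg, abs_of_pos inv_gold_pos]
        exact mul_le_of_le_one_left (pow_pos inv_gold_pos _).le (hc i)
    _ = 1 - gold⁻¹ ^ m := by
        rw [← sum_inv_gold_pow, Finset.sum_range]
    _ < 1 := by linarith [pow_pos inv_gold_pos m]

/-! ### Integer and real values of finite words -/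

section Words

variable {m : ℕ}

/-- The value of a word in the Fibonacci numeration system. -/
def blockInt (w : Fin m → Bool) : ℕ := ∑ j : Fin m, if w j then fibF (j + 1) else 0

/-- The value of the reversed word in base `gold`. -/
noncomputable def blockReal (w : Fin m → Bool) : ℝ :=
  ∑ i : Fin m, if w i then gold⁻¹ ^ ((i.rev : ℕ) + 2) else 0

lemma gold_pow_mul_blockReal (w : Fin m → Bool) :
    gold ^ (m + 3) * blockReal w
      = ∑ i : Fin m, (if w i then 1 else 0) * Real.goldenRatio ^ ((i : ℕ) + 2) := by
  rw [blockReal, Finset.mul_sum]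
  refine Finset.sum_congr rfl fun i _ => ?_
  have h : m + 3 = ((i : ℕ) + 2) + ((i.rev : ℕ) + 2) := by
    rw [Fin.val_rev]; omega
  split_ifs
  · rw [h, pow_add, mul_assoc, ← mul_pow, mul_inv_cancel₀ gold_pos.ne', one_pow, mul_one,
      one_mul, gold_eq]
  · simp

lemma blockInt_cast (w : Fin m → Bool) :
    (blockInt w : ℝ) = ∑ i : Fin m, (if w i then 1 else 0) * (Nat.fib ((i : ℕ) + 2) : ℝ) := by
  simp only [blockInt, fibF, Nat.cast_sum, Nat.cast_ite, Nat.cast_zero, ite_mul, one_mul, zero_mul]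

lemma goldenRatio_pow_eq (n : ℕ) :
    Real.goldenRatio ^ (n + 2) = Real.goldenRatio * Nat.fib (n + 2) + Nat.fib (n + 1) :=
  (Real.goldenRatio_mul_fib_succ_add_fib (n + 1)).symm

lemma goldenConj_pow_eq (n : ℕ) :
    Real.goldenConj ^ (n + 2)
      = Nat.fib (n + 1) + Nat.fib (n + 2) - Real.goldenRatio * Nat.fib (n + 2) := by
  rw [← Real.fib_succ_sub_goldenRatio_mul_fib, Nat.fib_add_two (n := n + 1)]
  push_cast; ring

lemma abs_sqrt_five_mul_blockInt_sub_lt (w : Fin m → Bool) :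
    |√5 * blockInt w - gold ^ (m + 3) * blockReal w| < 1 := by
  have h := abs_sum_goldenConj_lt (fun i => if w i then (1 : ℝ) else 0)
    (fun i => by split_ifs <;> simp)
  rw [← abs_neg] at h
  convert h using 2
  rw [blockInt_cast, gold_pow_mul_blockReal, Finset.mul_sum, ← Finset.sum_sub_distrib,
    ← Finset.sum_neg_distrib]
  refine Finset.sum_congr rfl fun i _ => ?_
  rw [Real.coe_fib_eq]
  field_simp
  ring

lemma blockReal_eq_of_blockInt_eq {w w' : Fin m → Bool} (h : blockInt w = blockInt w') :
    blockReal w = blockReal w' := by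
  set d : Fin m → ℤ := fun i => (if w i then 1 else 0) - (if w' i then 1 else 0) with hd
  set a : ℤ := ∑ i, d i * Nat.fib ((i : ℕ) + 1) with ha
  have h2 : ∑ i, (d i : ℝ) * Nat.fib ((i : ℕ) + 2) = 0 := by
    have : (blockInt w : ℝ) - blockInt w' = 0 := by rw [h, sub_self]
    rw [blockInt_cast, blockInt_cast, ← Finset.sum_sub_distrib] at this
    rw [← this]
    refine Finset.sum_congr rfl fun i _ => ?_
    simp only [hd]; push_cast; ring
  have h1 : ∑ i, (d i : ℝ) * Nat.fib ((i : ℕ) + 1) = a := by rw [ha]; push_cast; rfl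
  have hphi : ∑ i, (d i : ℝ) * Real.goldenRatio ^ ((i : ℕ) + 2) = a := by
    have : ∑ i, (d i : ℝ) * Real.goldenRatio ^ ((i : ℕ) + 2)
        = Real.goldenRatio * ∑ i, (d i : ℝ) * Nat.fib ((i : ℕ) + 2)
          + ∑ i, (d i : ℝ) * Nat.fib ((i : ℕ) + 1) := by
      rw [Finset.mul_sum, ← Finset.sum_add_distrib]
      refine Finset.sum_congr rfl fun i _ => ?_
      rw [goldenRatio_pow_eq]; ring
    rw [this, h2, h1]; ring
  have hpsi : ∑ i, (d i : ℝ) * Real.goldenConj ^ ((i : ℕ) + 2) = a := by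
    have : ∑ i, (d i : ℝ) * Real.goldenConj ^ ((i : ℕ) + 2)
        = (1 - Real.goldenRatio) * ∑ i, (d i : ℝ) * Nat.fib ((i : ℕ) + 2)
          + ∑ i, (d i : ℝ) * Nat.fib ((i : ℕ) + 1) := by
      rw [Finset.mul_sum, ← Finset.sum_add_distrib]
      refine Finset.sum_congr rfl fun i _ => ?_
      rw [goldenConj_pow_eq]; ring
    rw [this, h2, h1]; ring
  have ha0 : a = 0 := by
    have hlt := abs_sum_goldenConj_lt (fun i => (d i : ℝ)) fun i => by
      simp only [hd]; split_ifs <;> simp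
    rw [hpsi, ← Int.cast_abs] at hlt
    exact Int.abs_lt_one_iff.1 (by exact_mod_cast hlt)
  rw [ha0, Int.cast_zero] at hphi
  refine mul_left_cancel₀ (pow_pos gold_pos (m + 3)).ne' ?_
  rw [← sub_eq_zero, gold_pow_mul_blockReal, gold_pow_mul_blockReal, ← Finset.sum_sub_distrib]
  refine Eq.trans ?_ hphi
  refine Finset.sum_congr rfl fun i _ => ?_
  simp only [hd]; push_cast; ring

lemma blockReal_nonneg (w : Fin m → Bool) : 0 ≤ blockReal w := by
  refine Finset.sum_nonneg fun i _ => ?_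
  split_ifs
  · exact (pow_pos inv_gold_pos _).le
  · exact le_rfl

lemma blockReal_le (w : Fin m → Bool) : blockReal w ≤ 1 - gold⁻¹ ^ m := by
  rw [← sum_inv_gold_pow, Finset.sum_range, ← Equiv.sum_comp Fin.revPerm]
  refine Finset.sum_le_sum fun i _ => ?_
  split_ifs
  · exact le_rfl
  · exact (pow_pos inv_gold_pos _).le

/-- The number of words with the same Fibonacci value as `w`. -/
def mult (w : Fin m → Bool) : ℕ := countRep m (blockInt w)

lemma mult_eq (w : Fin m → Bool) :
    mult w = (Finset.univ.filter fun w' : Fin m → Bool => blockInt w' = blockInt w).card := rfl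

lemma mult_pos (w : Fin m → Bool) : 0 < mult w := by
  rw [mult_eq]
  exact Finset.card_pos.2 ⟨w, by simp⟩

lemma sum_inv_mult_le (z : ℝ) :
    ∑ w : Fin m → Bool with |blockReal w - z| ≤ 3 * gold⁻¹ ^ m, (mult w : ℝ)⁻¹ ≤ 29 := by
  classical
  set S := Finset.univ.filter fun w : Fin m → Bool => |blockReal w - z| ≤ 3 * gold⁻¹ ^ m with hS
  have hcard : (S.image blockInt).card ≤ 29 := by
    rcases S.eq_empty_or_nonempty with h | ⟨w₀, hw₀⟩
    · simp [h]
    · have hsub : S.image blockInt ⊆ Finset.Icc (blockInt w₀ - 14) (blockInt w₀ + 14) := by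
        intro v hv
        obtain ⟨w, hw, rfl⟩ := Finset.mem_image.1 hv
        have hg : gold < 1.62 := by
          rw [gold]
          have : √5 < 2.24 := by
            rw [Real.sqrt_lt' (by norm_num)]; norm_num
          linarith
        have hg3 : gold ^ 3 < 4.3 :=
          (pow_lt_pow_left₀ hg gold_pos.le (by norm_num)).trans (by norm_num)
        have hscale : gold ^ (m + 3) * gold⁻¹ ^ m = gold ^ 3 := by
          rw [pow_add, mul_right_comm, ← mul_pow, mul_inv_cancel₀ gold_pos.ne', one_pow, one_mul]
        have hz : ∀ w ∈ S, |√5 * blockInt w - gold ^ (m + 3) * z| < 14 := by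
          intro w hw
          have hw := (Finset.mem_filter.1 hw).2
          have h1 := abs_sqrt_five_mul_blockInt_sub_lt w
          have h2 : |gold ^ (m + 3) * blockReal w - gold ^ (m + 3) * z| ≤ 3 * gold ^ 3 := by
            rw [← mul_sub, abs_mul, abs_of_pos (pow_pos gold_pos _), ← hscale]
            calc _ ≤ gold ^ (m + 3) * (3 * gold⁻¹ ^ m) :=
                  mul_le_mul_of_nonneg_left hw (pow_pos gold_pos _).le
              _ = _ := by ring
          calc _ ≤ _ := abs_sub_le _ (gold ^ (m + 3) * blockReal w) _
            _ < 14 := by linarith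
        have h0 := abs_lt.1 (hz w₀ hw₀)
        have h1 := abs_lt.1 (hz w hw)
        have h5 : (2 : ℝ) < √5 := by
          rw [Real.lt_sqrt (by norm_num)]; norm_num
        have hu : (blockInt w : ℝ) < blockInt w₀ + 14 := by
          by_contra! hcon
          nlinarith
        have hl : (blockInt w₀ : ℝ) < blockInt w + 14 := by
          by_contra! hcon
          nlinarith
        have hu' : blockInt w < blockInt w₀ + 14 := by exact_mod_cast hu
        have hl' : blockInt w₀ < blockInt w + 14 := by exact_mod_cast hl
        rw [Finset.mem_Icc]
        omega
      refine (Finset.card_le_card hsub).trans ?_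
      rw [Nat.card_Icc]
      omega
  rw [← Finset.sum_fiberwise_of_maps_to (fun w hw => Finset.mem_image_of_mem blockInt hw)]
  calc _ ≤ ∑ v ∈ S.image blockInt, (1 : ℝ) := by
        refine Finset.sum_le_sum fun v hv => ?_
        obtain ⟨w₀, hw₀, rfl⟩ := Finset.mem_image.1 hv
        have hc : ∀ w ∈ S.filter (fun w => blockInt w = blockInt w₀),
            (mult w : ℝ)⁻¹ = (mult w₀ : ℝ)⁻¹ := by
          intro w hw
          rw [mult, mult, (Finset.mem_filter.1 hw).2]
        rw [Finset.sum_congr rfl hc, Finset.sum_const, nsmul_eq_mul, ← div_eq_mul_inv]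
        refine div_le_one_of_le₀ ?_ (Nat.cast_nonneg _)
        rw [Nat.cast_le, mult_eq]
        exact Finset.card_le_card (Finset.filter_subset_filter _ (Finset.subset_univ _))
    _ = (S.image blockInt).card := by simp
    _ ≤ 29 := by exact_mod_cast hcard

end Words

/-! ### Sequences of words -/

/-- The value in base `gold` of a concatenation of `n` words of length `m`. -/
noncomputable def concatReal {m n : ℕ} (u : Fin n → Fin m → Bool) : ℝ :=
  ∑ j : Fin n, gold⁻¹ ^ ((j : ℕ) * m) * blockReal (u j)

lemma concatReal_cons {m n : ℕ} (w : Fin m → Bool) (u : Fin n → Fin m → Bool) :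
    concatReal (Fin.cons w u : Fin (n + 1) → Fin m → Bool)
      = blockReal w + gold⁻¹ ^ m * concatReal u := by
  rw [concatReal, Fin.sum_univ_succ, concatReal, Finset.mul_sum]
  simp only [Fin.val_zero, zero_mul, pow_zero, one_mul, Fin.cons_zero, Fin.val_succ, Fin.cons_succ]
  congr 1
  refine Finset.sum_congr rfl fun j _ => ?_
  rw [add_mul, one_mul, pow_add]
  ring

lemma concatReal_mem {m : ℕ} : ∀ {n : ℕ} (u : Fin n → Fin m → Bool),
    0 ≤ concatReal u ∧ concatReal u ≤ 1
  | 0, u => by simp [concatReal]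
  | n + 1, u => by
    rw [← Fin.cons_self_tail u, concatReal_cons]
    obtain ⟨h0, h1⟩ := concatReal_mem (Fin.tail u)
    have hp := pow_pos inv_gold_pos m
    have hb := blockReal_nonneg (u 0)
    have hb' := blockReal_le (u 0)
    constructor
    · positivity
    · nlinarith

lemma sum_prod_inv_mult_le {m : ℕ} (n : ℕ) (z : ℝ) :
    ∑ u : Fin n → Fin m → Bool with |concatReal u - z| ≤ 2 * gold⁻¹ ^ (n * m),
      ∏ j, (mult (u j) : ℝ)⁻¹ ≤ 29 ^ n := by
  classical
  induction n generalizing z with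
  | zero =>
    calc _ ≤ ∑ u : Fin 0 → Fin m → Bool, ∏ j, (mult (u j) : ℝ)⁻¹ :=
          Finset.sum_le_sum_of_subset_of_nonneg (Finset.filter_subset _ _)
            fun u _ _ => Finset.prod_nonneg fun j _ => by positivity
      _ ≤ _ := by simp
  | succ n ih =>
    have hp := pow_pos inv_gold_pos m
    have key : ∀ (w : Fin m → Bool) (u : Fin n → Fin m → Bool),
        |concatReal (Fin.cons w u : Fin (n + 1) → Fin m → Bool) - z|
          ≤ 2 * gold⁻¹ ^ ((n + 1) * m) →
        |blockReal w - z| ≤ 3 * gold⁻¹ ^ m ∧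
          |concatReal u - gold ^ m * (z - blockReal w)| ≤ 2 * gold⁻¹ ^ (n * m) := by
      intro w u h
      rw [concatReal_cons] at h
      have hn : gold⁻¹ ^ ((n + 1) * m) = gold⁻¹ ^ m * gold⁻¹ ^ (n * m) := by
        rw [← pow_add]; congr 1; ring
      have hpn : gold⁻¹ ^ (n * m) ≤ 1 := pow_le_one₀ inv_gold_pos.le inv_gold_lt_one.le
      obtain ⟨h0, h1⟩ := concatReal_mem u
      constructor
      · rw [hn] at h
        rw [abs_le] at h ⊢
        constructor <;> nlinarith
      · have hgm : gold⁻¹ ^ m * gold ^ m = 1 := by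
          rw [← mul_pow, inv_mul_cancel₀ gold_pos.ne', one_pow]
        have : blockReal w + gold⁻¹ ^ m * concatReal u - z
            = gold⁻¹ ^ m * (concatReal u - gold ^ m * (z - blockReal w)) := by
          rw [mul_sub, ← mul_assoc, hgm]; ring
        rw [this, abs_mul, abs_of_pos hp, hn, mul_left_comm] at h
        exact le_of_mul_le_mul_left h hp
    rw [Finset.sum_filter, ← Equiv.sum_comp (Fin.consEquiv fun _ => Fin m → Bool),
      Fintype.sum_prod_type]
    calc _ ≤ ∑ w : Fin m → Bool, if |blockReal w - z| ≤ 3 * gold⁻¹ ^ m then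
            (mult w : ℝ)⁻¹ * 29 ^ n else 0 := by
          refine Finset.sum_le_sum fun w _ => ?_
          simp only [Fin.consEquiv_apply, Fin.prod_univ_succ, Fin.cons_zero, Fin.cons_succ]
          split_ifs with hw
          · refine le_trans ?_ (mul_le_mul_of_nonneg_left (ih (gold ^ m * (z - blockReal w)))
              (by positivity))
            rw [Finset.sum_filter, Finset.mul_sum]
            refine Finset.sum_le_sum fun u _ => ?_
            split_ifs with h1 h2
            · exact le_rfl
            · exact absurd (key w u h1).2 h2
            · positivity
            · simp
          · refine (Finset.sum_eq_zero fun u _ => if_neg fun h => hw (key w u h).1).le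
      _ = (∑ w : Fin m → Bool with
            |blockReal w - z| ≤ 3 * gold⁻¹ ^ m, (mult w : ℝ)⁻¹) * 29 ^ n := by
          rw [Finset.sum_filter, Finset.sum_mul]
          refine Finset.sum_congr rfl fun w _ => ?_
          split_ifs <;> simp
      _ ≤ 29 ^ (n + 1) := by
          rw [pow_succ']
          exact mul_le_mul_of_nonneg_right (sum_inv_mult_le z) (by positivity)

/-! ### The coding map -/

lemma summable_inv_gold_pow : Summable fun k : ℕ => gold⁻¹ ^ (k + 2) :=
  (summable_nat_add_iff 2).2 (summable_geometric_of_lt_one inv_gold_pos.le inv_gold_lt_one)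

lemma piMap_term_nonneg (ε : ℕ → Bool) (k : ℕ) : 0 ≤ if ε k then gold⁻¹ ^ (k + 2) else 0 := by
  split_ifs
  · exact (pow_pos inv_gold_pos _).le
  · exact le_rfl

lemma piMap_term_le (ε : ℕ → Bool) (k : ℕ) :
    (if ε k then gold⁻¹ ^ (k + 2) else 0) ≤ gold⁻¹ ^ (k + 2) := by
  split_ifs
  · exact le_rfl
  · exact (pow_pos inv_gold_pos _).le

lemma summable_piMap (ε : ℕ → Bool) :
    Summable fun k : ℕ => if ε k then gold⁻¹ ^ (k + 2) else 0 :=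
  summable_inv_gold_pow.of_nonneg_of_le (piMap_term_nonneg ε) (piMap_term_le ε)

lemma piMap_nonneg (ε : ℕ → Bool) : 0 ≤ piMap ε := tsum_nonneg (piMap_term_nonneg ε)

lemma piMap_le_one (ε : ℕ → Bool) : piMap ε ≤ 1 := by
  refine (summable_piMap ε).tsum_le_of_sum_range_le fun n => ?_
  calc _ ≤ ∑ k ∈ Finset.range n, gold⁻¹ ^ (k + 2) :=
        Finset.sum_le_sum fun k _ => piMap_term_le ε k
    _ ≤ 1 := by
        rw [sum_inv_gold_pow]
        linarith [pow_pos inv_gold_pos n]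

lemma piMap_eq_sum_add (N : ℕ) (ε : ℕ → Bool) :
    piMap ε = ∑ k ∈ Finset.range N, (if ε k then gold⁻¹ ^ (k + 2) else 0)
      + gold⁻¹ ^ N * piMap fun k => ε (k + N) := by
  rw [piMap, ← (summable_piMap ε).sum_add_tsum_nat_add N, piMap, ← tsum_mul_left]
  congr 1
  refine tsum_congr fun k => ?_
  split_ifs
  · rw [← pow_add]; congr 1; ring
  · simp

lemma measurable_piMap : Measurable piMap := by
  refine Continuous.measurable (continuous_tsum (fun k => ?_) summable_inv_gold_pow fun k ε => ?_)
  · exact (continuous_of_discreteTopology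
      (f := fun b : Bool => if b then gold⁻¹ ^ (k + 2) else 0)).comp (continuous_apply k)
  · rw [Real.norm_of_nonneg (piMap_term_nonneg ε k)]
    exact piMap_term_le ε k

/-- The `j`-th block of length `m` of a sequence, read backwards. -/
def block (m j : ℕ) (ε : ℕ → Bool) : Fin m → Bool := fun i => ε (j * m + i.rev)

/-- The first `n` blocks of length `m` of a sequence, each read backwards. -/
def blocks (m n : ℕ) (ε : ℕ → Bool) : Fin n → Fin m → Bool := fun j => block m j ε

lemma measurable_block (m j : ℕ) : Measurable (block m j) :=
  measurable_pi_lambda _ fun _ => measurable_pi_apply _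

lemma measurable_blocks (m n : ℕ) : Measurable (blocks m n) :=
  measurable_pi_lambda _ fun _ => measurable_block m _

lemma blockReal_block_zero (m : ℕ) (ε : ℕ → Bool) :
    blockReal (block m 0 ε) = ∑ k ∈ Finset.range m, if ε k then gold⁻¹ ^ (k + 2) else 0 := by
  rw [Finset.sum_range, blockReal, ← Equiv.sum_comp Fin.revPerm]
  simp [block]

lemma piMap_eq_concatReal_add (m n : ℕ) (ε : ℕ → Bool) :
    piMap ε = concatReal (blocks m n ε) + gold⁻¹ ^ (n * m) * piMap fun k => ε (k + n * m) := by
  induction n with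
  | zero => simp [concatReal]
  | succ n ih =>
    have hblock : block m n ε = block m 0 fun k => ε (k + n * m) := by
      funext i
      simp only [block]
      congr 1
      ring
    rw [ih, piMap_eq_sum_add m, ← blockReal_block_zero, ← hblock, concatReal, concatReal,
      Fin.sum_univ_castSucc]
    have harg : (fun k => ε (k + m + n * m)) = fun k => ε (k + (n + 1) * m) := by
      funext k; congr 1; ring
    simp only [harg, blocks, Fin.val_castSucc, Fin.val_last, add_mul (n : ℕ) 1 m, one_mul, pow_add]
    ring

lemma abs_piMap_sub_concatReal_le (m n : ℕ) (ε : ℕ → Bool) :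
    |piMap ε - concatReal (blocks m n ε)| ≤ gold⁻¹ ^ (n * m) := by
  have hp := pow_pos inv_gold_pos (n * m)
  rw [piMap_eq_concatReal_add m n ε, add_sub_cancel_left, abs_of_nonneg
    (mul_nonneg hp.le (piMap_nonneg _))]
  exact mul_le_of_le_one_right hp.le (piMap_le_one _)

lemma abs_piMap_sub_piMap_le {m n : ℕ} {ε ε' : ℕ → Bool}
    (h : concatReal (blocks m n ε) = concatReal (blocks m n ε')) :
    |piMap ε - piMap ε'| ≤ gold⁻¹ ^ (n * m) := by
  have hp := pow_pos inv_gold_pos (n * m)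
  rw [piMap_eq_concatReal_add m n ε, piMap_eq_concatReal_add m n ε', h, add_sub_add_left_eq_sub,
    ← mul_sub, abs_mul, abs_of_pos hp]
  refine mul_le_of_le_one_right hp.le (abs_le.2 ⟨?_, ?_⟩) <;>
    linarith [piMap_nonneg fun k => ε (k + n * m), piMap_le_one fun k => ε (k + n * m),
      piMap_nonneg fun k => ε' (k + n * m), piMap_le_one fun k => ε' (k + n * m)]

/-! ### The distribution of blocks -/

namespace IsCoinMeasure

variable {p : Measure (ℕ → Bool)}

lemma isProbabilityMeasure (hp : IsCoinMeasure p) : IsProbabilityMeasure p :=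
  ⟨by simpa using hp ∅ fun _ => false⟩

lemma measure_cylinder (hp : IsCoinMeasure p)
    {ι : Type*} [Fintype ι] {e : ι → ℕ} (he : Function.Injective e)
    (u : ι → Bool) : p {ε | ∀ i, ε (e i) = u i} = (2 : ℝ≥0∞)⁻¹ ^ Fintype.card ι := by
  have h := hp (Finset.univ.map ⟨e, he⟩) (Function.extend e u fun _ => false)
  simpa [he.extend_apply] using h

lemma measureReal_cylinder (hp : IsCoinMeasure p)
    {ι : Type*} [Fintype ι] {e : ι → ℕ} (he : Function.Injective e)
    (u : ι → Bool) : p.real {ε | ∀ i, ε (e i) = u i} = (2 : ℝ)⁻¹ ^ Fintype.card ι := by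
  rw [measureReal_def, hp.measure_cylinder he, ENNReal.toReal_pow, ENNReal.toReal_inv]
  simp

lemma block_index_inj {m j j' : ℕ} {i i' : Fin m}
    (h : j * m + (i.rev : ℕ) = j' * m + (i'.rev : ℕ)) : j = j' ∧ i = i' := by
  have hm : 0 < m := i.pos
  have hj : ∀ (j : ℕ) (i : Fin m), (j * m + (i.rev : ℕ)) / m = j := fun j i => by
    rw [mul_comm, Nat.mul_add_div hm, Nat.div_eq_of_lt i.rev.isLt, add_zero]
  have hjj : j = j' := by rw [← hj j i, h, hj]
  subst hjj
  exact ⟨rfl, Fin.rev_injective (Fin.ext (by omega))⟩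

lemma measure_block_eq (hp : IsCoinMeasure p) (m j : ℕ) (w : Fin m → Bool) :
    p (block m j ⁻¹' {w}) = (2 : ℝ≥0∞)⁻¹ ^ m := by
  have h := hp.measure_cylinder (e := fun i : Fin m => j * m + (i.rev : ℕ))
    (fun i i' hi => (block_index_inj hi).2) w
  rw [Fintype.card_fin] at h
  rw [← h]
  congr 1
  ext ε
  simp [block, funext_iff]

lemma measure_block_pair_eq (hp : IsCoinMeasure p)
    (m : ℕ) {j j' : ℕ} (hj : j ≠ j') (w w' : Fin m → Bool) :
    p ((fun ε => (block m j ε, block m j' ε)) ⁻¹' {(w, w')})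
      = (2 : ℝ≥0∞)⁻¹ ^ m * (2 : ℝ≥0∞)⁻¹ ^ m := by
  have h := hp.measure_cylinder
    (e := Sum.elim (fun i : Fin m => j * m + (i.rev : ℕ)) (fun i : Fin m => j' * m + (i.rev : ℕ)))
    (Function.Injective.sumElim (fun i i' hi => (block_index_inj hi).2)
      (fun i i' hi => (block_index_inj hi).2) fun i i' hi => hj (block_index_inj hi).1)
    (Sum.elim w w')
  rw [Fintype.card_sum, Fintype.card_fin, pow_add] at h
  rw [← h]
  congr 1
  ext ε
  simp [block, funext_iff]

lemma measureReal_blocks_mem (hp : IsCoinMeasure p) (m n : ℕ) (A : Finset (Fin n → Fin m → Bool)) :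
    p.real (blocks m n ⁻¹' A) = A.card * ((2 : ℝ)⁻¹ ^ m) ^ n := by
  have := hp.isProbabilityMeasure
  rw [← sum_measureReal_preimage_singleton A fun u _ =>
    measurable_blocks m n (measurableSet_singleton u)]
  rw [Finset.sum_congr rfl fun u _ => ?_, Finset.sum_const, nsmul_eq_mul]
  have h := hp.measureReal_cylinder (e := fun a : Fin n × Fin m => a.1 * m + (a.2.rev : ℕ))
    (fun a b hab => Prod.ext (Fin.ext (block_index_inj hab).1) (block_index_inj hab).2)
    (fun a => u a.1 a.2)
  rw [Fintype.card_prod, Fintype.card_fin, Fintype.card_fin, mul_comm, pow_mul] at h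
  rw [← h]
  congr 1
  ext ε
  simp [blocks, block, funext_iff]

end IsCoinMeasure

section Entropy

variable {m : ℕ}

/-- The probability that a random word has the same Fibonacci value as `w`. -/
noncomputable def wordProb (w : Fin m → Bool) : ℝ := mult w / 2 ^ m

lemma wordProb_pos (w : Fin m → Bool) : 0 < wordProb w :=
  div_pos (Nat.cast_pos.2 (mult_pos w)) (by positivity)

lemma sum_fibF (m : ℕ) : ∑ j : Fin m, fibF (j + 1) + 2 = fibF (m + 2) := by
  induction m with
  | zero => simp [fibF]; rfl
  | succ m ih =>
    rw [Fin.sum_univ_castSucc]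
    simp only [Fin.val_castSucc, Fin.val_last, fibF] at ih ⊢
    have h : Nat.fib (m + 1 + 2 + 1) = Nat.fib (m + 1 + 1) + Nat.fib (m + 2 + 1) :=
      Nat.fib_add_two
    omega

lemma blockInt_mem_range (w : Fin m → Bool) : blockInt w ∈ Finset.range (fibF (m + 2) - 1) := by
  have h : blockInt w ≤ ∑ j : Fin m, fibF (j + 1) := by
    refine Finset.sum_le_sum fun j _ => ?_
    split_ifs
    · exact le_rfl
    · exact Nat.zero_le _
  rw [Finset.mem_range, ← sum_fibF]
  omega

lemma Hent_eq_sum (m : ℕ) :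
    Hent m = ∑ w : Fin m → Bool, (2 : ℝ)⁻¹ ^ m * -Real.logb gold (wordProb w) := by
  rw [← Finset.sum_fiberwise_of_maps_to fun w _ => blockInt_mem_range w, Hent,
    ← Finset.sum_neg_distrib]
  refine Finset.sum_congr rfl fun k _ => ?_
  have hc : ∀ w ∈ Finset.univ.filter (fun w : Fin m → Bool => blockInt w = k),
      (2 : ℝ)⁻¹ ^ m * -Real.logb gold (wordProb w)
        = (2 : ℝ)⁻¹ ^ m * -Real.logb gold ((countRep m k : ℝ) / 2 ^ m) := by
    intro w hw
    rw [wordProb, mult, (Finset.mem_filter.1 hw).2]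
  rw [Finset.sum_congr rfl hc, Finset.sum_const, nsmul_eq_mul, inv_pow]
  change _ = (countRep m k : ℝ) * _
  ring

end Entropy

/-! ### Mass of small intervals -/

namespace IsCoinMeasure

variable {p : Measure (ℕ → Bool)}

lemma isProbabilityMeasure_erdosOf (hp : IsCoinMeasure p) : IsProbabilityMeasure (erdosOf p) :=
  have := hp.isProbabilityMeasure
  Measure.isProbabilityMeasure_map measurable_piMap.aemeasurable

lemma prod_wordProb_le (hp : IsCoinMeasure p) (m n : ℕ) (ε : ℕ → Bool) :
    ∏ j : Fin n, wordProb (block m j ε)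
      ≤ (erdosOf p).real (Set.Icc (piMap ε - gold⁻¹ ^ (n * m)) (piMap ε + gold⁻¹ ^ (n * m))) := by
  have := hp.isProbabilityMeasure
  set A : Finset (Fin n → Fin m → Bool) := Fintype.piFinset fun j =>
    Finset.univ.filter fun w => blockInt w = blockInt (block m j ε) with hA
  have hcard : (A.card : ℝ) = ∏ j : Fin n, (mult (block m j ε) : ℝ) := by
    rw [hA, Fintype.card_piFinset]
    push_cast
    rfl
  calc ∏ j : Fin n, wordProb (block m j ε) = p.real (blocks m n ⁻¹' A) := by
        rw [hp.measureReal_blocks_mem, hcard]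
        simp only [wordProb, Finset.prod_div_distrib, Finset.prod_const, Finset.card_univ,
          Fintype.card_fin]
        rw [inv_pow, inv_pow, div_eq_mul_inv]
    _ ≤ _ := by
        rw [erdosOf, map_measureReal_apply measurable_piMap measurableSet_Icc]
        refine measureReal_mono fun ε' hε' => ?_
        have hval : concatReal (blocks m n ε') = concatReal (blocks m n ε) := by
          refine Finset.sum_congr rfl fun j _ => ?_
          rw [blockReal_eq_of_blockInt_eq]
          exact (Finset.mem_filter.1 (Fintype.mem_piFinset.1 hε' j)).2
        have h := abs_le.1 (abs_piMap_sub_piMap_le hval)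
        exact ⟨by linarith [h.1], by linarith [h.2]⟩

lemma sum_prod_inv_mult_mul_measureReal_le (m n : ℕ) (μ : Measure ℝ) [IsProbabilityMeasure μ] :
    ∑ u : Fin n → Fin m → Bool, (∏ j, (mult (u j) : ℝ)⁻¹) *
      μ.real (Set.Icc (concatReal u - 2 * gold⁻¹ ^ (n * m)) (concatReal u + 2 * gold⁻¹ ^ (n * m)))
      ≤ 29 ^ n := by
  set I : (Fin n → Fin m → Bool) → Set ℝ := fun u =>
    Set.Icc (concatReal u - 2 * gold⁻¹ ^ (n * m)) (concatReal u + 2 * gold⁻¹ ^ (n * m)) with hI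
  have hint : ∀ u, Integrable (fun z => (∏ j, (mult (u j) : ℝ)⁻¹) * (I u).indicator 1 z) μ :=
    fun u => ((integrable_indicator_iff measurableSet_Icc).2
      (integrable_const (1 : ℝ)).integrableOn).const_mul _
  calc _ = ∫ z, ∑ u : Fin n → Fin m → Bool,
        (∏ j, (mult (u j) : ℝ)⁻¹) * (I u).indicator 1 z ∂μ := by
        rw [integral_finsetSum _ fun u _ => hint u]
        refine Finset.sum_congr rfl fun u _ => ?_
        rw [integral_const_mul, integral_indicator_one measurableSet_Icc]
    _ ≤ ∫ _, (29 : ℝ) ^ n ∂μ := by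
        refine integral_mono (integrable_finsetSum _ fun u _ => hint u) (integrable_const _)
          fun z => ?_
        refine le_trans (le_of_eq ?_) (sum_prod_inv_mult_le (m := m) n z)
        rw [Finset.sum_filter]
        refine Finset.sum_congr rfl fun u _ => ?_
        have hiff : z ∈ I u ↔ |concatReal u - z| ≤ 2 * gold⁻¹ ^ (n * m) := by
          rw [abs_sub_le_iff]
          simp only [hI, Set.mem_Icc]
          constructor <;> rintro ⟨h1, h2⟩ <;> constructor <;> linarith
        by_cases hz : z ∈ I u
        · rw [Set.indicator_of_mem hz, if_pos (hiff.1 hz)]; simp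
        · rw [Set.indicator_of_notMem hz, if_neg fun h => hz (hiff.2 h)]; simp
    _ = 29 ^ n := by simp

lemma measureReal_large_mass_le (hp : IsCoinMeasure p) (m n : ℕ) :
    p.real {ε | 58 ^ n * ∏ j : Fin n, wordProb (block m j ε)
      < (erdosOf p).real (Set.Icc (concatReal (blocks m n ε) - 2 * gold⁻¹ ^ (n * m))
        (concatReal (blocks m n ε) + 2 * gold⁻¹ ^ (n * m)))} ≤ (2 : ℝ)⁻¹ ^ n := by
  classical
  have := hp.isProbabilityMeasure_erdosOf
  set M : (Fin n → Fin m → Bool) → ℝ := fun u => (erdosOf p).real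
    (Set.Icc (concatReal u - 2 * gold⁻¹ ^ (n * m)) (concatReal u + 2 * gold⁻¹ ^ (n * m))) with hM
  set A : Finset (Fin n → Fin m → Bool) := Finset.univ.filter fun u =>
    58 ^ n * ∏ j, wordProb (u j) < M u with hA
  have hset : {ε | 58 ^ n * ∏ j : Fin n, wordProb (block m j ε) < M (blocks m n ε)}
      = blocks m n ⁻¹' A := by
    ext ε
    simp [hA, blocks]
  have hprod : ∀ u : Fin n → Fin m → Bool,
      (∏ j, wordProb (u j)) * ∏ j, (mult (u j) : ℝ)⁻¹ = ((2 : ℝ)⁻¹ ^ m) ^ n := by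
    intro u
    rw [← Finset.prod_mul_distrib, Finset.prod_congr rfl fun j _ => ?_, Finset.prod_const,
      Finset.card_univ, Fintype.card_fin]
    have : (mult (u j) : ℝ) ≠ 0 := Nat.cast_ne_zero.2 (mult_pos _).ne'
    rw [wordProb, inv_pow]
    field_simp
  change p.real {ε | 58 ^ n * ∏ j : Fin n, wordProb (block m j ε) < M (blocks m n ε)} ≤ _
  rw [hset, hp.measureReal_blocks_mem]
  have hle : 58 ^ n * (A.card * ((2 : ℝ)⁻¹ ^ m) ^ n) ≤ 29 ^ n := by
    calc _ = ∑ u ∈ A, 58 ^ n * (∏ j, wordProb (u j)) * ∏ j, (mult (u j) : ℝ)⁻¹ := by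
          rw [Finset.sum_congr rfl fun u _ => by rw [mul_assoc, hprod], Finset.sum_const,
            nsmul_eq_mul]
          ring
      _ ≤ ∑ u ∈ A, (∏ j, (mult (u j) : ℝ)⁻¹) * M u := by
          refine Finset.sum_le_sum fun u hu => ?_
          rw [mul_comm]
          exact mul_le_mul_of_nonneg_left (Finset.mem_filter.1 hu).2.le
            (Finset.prod_nonneg fun j _ => by positivity)
      _ ≤ ∑ u, (∏ j, (mult (u j) : ℝ)⁻¹) * M u :=
          Finset.sum_le_sum_of_subset_of_nonneg (Finset.filter_subset _ _) fun u _ _ =>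
            mul_nonneg (Finset.prod_nonneg fun j _ => by positivity) measureReal_nonneg
      _ ≤ 29 ^ n := sum_prod_inv_mult_mul_measureReal_le m n _
  have h58 : (58 : ℝ) ^ n * (2 : ℝ)⁻¹ ^ n = 29 ^ n := by
    rw [← mul_pow]; norm_num
  rw [← h58] at hle
  exact le_of_mul_le_mul_left hle (by positivity)

lemma ae_eventually_mass_le (hp : IsCoinMeasure p) (m : ℕ) :
    ∀ᵐ ε ∂p, ∀ᶠ n : ℕ in atTop,
      (erdosOf p).real (Set.Icc (piMap ε - gold⁻¹ ^ (n * m)) (piMap ε + gold⁻¹ ^ (n * m)))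
        ≤ 58 ^ n * ∏ j : Fin n, wordProb (block m j ε) := by
  have := hp.isProbabilityMeasure
  have := hp.isProbabilityMeasure_erdosOf
  have hsum : ∑' n : ℕ, p {ε | 58 ^ n * ∏ j : Fin n, wordProb (block m j ε)
      < (erdosOf p).real (Set.Icc (concatReal (blocks m n ε) - 2 * gold⁻¹ ^ (n * m))
        (concatReal (blocks m n ε) + 2 * gold⁻¹ ^ (n * m)))} ≠ ∞ := by
    refine ne_top_of_le_ne_top (b := ∑' n : ℕ, (2 : ℝ≥0∞)⁻¹ ^ n) ?_ ?_
    · rw [ENNReal.tsum_geometric, ENNReal.one_sub_inv_two, inv_inv]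
      exact ENNReal.ofNat_ne_top
    · refine ENNReal.tsum_le_tsum fun n => ?_
      refine (ENNReal.toReal_le_toReal (measure_ne_top _ _) (by finiteness)).1 ?_
      rw [ENNReal.toReal_pow, ENNReal.toReal_inv, ENNReal.toReal_ofNat]
      exact hp.measureReal_large_mass_le m n
  filter_upwards [ae_eventually_notMem hsum] with ε hε
  filter_upwards [hε] with n hn
  refine le_trans (measureReal_mono fun x hx => ?_) (not_lt.1 hn)
  have h := abs_le.1 (abs_piMap_sub_concatReal_le m n ε)
  exact ⟨by linarith [hx.1, h.1], by linarith [hx.2, h.2]⟩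

lemma ae_tendsto_sum_info (hp : IsCoinMeasure p) (m : ℕ) :
    ∀ᵐ ε ∂p, Tendsto (fun n : ℕ =>
      (∑ j ∈ Finset.range n, -Real.logb gold (wordProb (block m j ε))) / n)
      atTop (𝓝 (Hent m)) := by
  have := hp.isProbabilityMeasure
  have hmap : ∀ j, p.map (block m j) = p.map (block m 0) := fun j =>
    Measure.ext_of_singleton fun w => by
      rw [Measure.map_apply (measurable_block m j) (measurableSet_singleton w),
        Measure.map_apply (measurable_block m 0) (measurableSet_singleton w),
        hp.measure_block_eq, hp.measure_block_eq]
  set f : (Fin m → Bool) → ℝ := fun w => -Real.logb gold (wordProb w) with hf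
  have hfm : Measurable f := measurable_of_finite f
  have hint0 : Integrable f (p.map (block m 0)) := by
    have := Measure.isProbabilityMeasure_map (μ := p) (measurable_block m 0).aemeasurable
    exact Integrable.of_finite
  have hexp : ∫ ε, f (block m 0 ε) ∂p = Hent m := by
    rw [← integral_map (measurable_block m 0).aemeasurable hfm.aestronglyMeasurable,
      integral_fintype hint0, Hent_eq_sum]
    refine Finset.sum_congr rfl fun w _ => ?_
    rw [map_measureReal_apply (measurable_block m 0) (measurableSet_singleton w),
      measureReal_def, hp.measure_block_eq, smul_eq_mul, ENNReal.toReal_pow, ENNReal.toReal_inv,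
      ENNReal.toReal_ofNat]
  rw [← hexp]
  refine ProbabilityTheory.strong_law_ae_real (fun j ε => f (block m j ε)) ?_ ?_ ?_
  · exact hint0.comp_measurable (measurable_block m 0)
  · intro j j' hj
    refine ProbabilityTheory.IndepFun.comp (f := block m j) (g := block m j') ?_ hfm hfm
    rw [ProbabilityTheory.indepFun_iff_map_prod_eq_prod_map_map
      (measurable_block m j).aemeasurable (measurable_block m j').aemeasurable]
    refine Measure.ext_of_singleton fun w => ?_
    rw [Measure.map_apply ((measurable_block m j).prodMk (measurable_block m j'))
      (measurableSet_singleton w), hp.measure_block_pair_eq m hj w.1 w.2,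
      ← Set.singleton_prod_singleton, Measure.prod_prod,
      Measure.map_apply (measurable_block m j) (measurableSet_singleton _),
      Measure.map_apply (measurable_block m j') (measurableSet_singleton _),
      hp.measure_block_eq, hp.measure_block_eq]
  · intro j
    exact ProbabilityTheory.IdentDistrib.comp (u := f)
      ⟨(measurable_block m j).aemeasurable, (measurable_block m 0).aemeasurable, hmap j⟩ hfm

end IsCoinMeasure

/-! ### Interpolation -/

lemma exists_bounds_of_monotone {A : ℝ → ℝ} (hA : Monotone A) {s : ℕ → ℝ} {h c : ℝ} {m : ℕ}
    (hm : 0 < m) (hupper : ∀ n : ℕ, A ((n * m : ℕ) : ℝ) ≤ s n)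
    (hlower : ∀ᶠ n : ℕ in atTop, s n - n * c ≤ A ((n * m : ℕ) : ℝ))
    (hs : Tendsto (fun n : ℕ => s n / n) atTop (𝓝 h)) :
    ∃ L U : ℝ → ℝ, (∀ᶠ t in atTop, L t ≤ A t / t) ∧ (∀ᶠ t in atTop, A t / t ≤ U t) ∧
      Tendsto L atTop (𝓝 (h / m - c / m)) ∧ Tendsto U atTop (𝓝 (h / m)) := by
  have hm' : (0 : ℝ) < m := Nat.cast_pos.2 hm
  set N : ℝ → ℕ := fun t => ⌊(m : ℝ)⁻¹ * t⌋₊ with hN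
  have hNtop : Tendsto N atTop atTop :=
    tendsto_nat_floor_atTop.comp (tendsto_id.const_mul_atTop (inv_pos.2 hm'))
  have hNdiv : Tendsto (fun t => (N t : ℝ) / t) atTop (𝓝 (m : ℝ)⁻¹) :=
    tendsto_nat_floor_mul_div_atTop (inv_pos.2 hm').le
  have hNdiv1 : Tendsto (fun t => ((N t + 1 : ℕ) : ℝ) / t) atTop (𝓝 (m : ℝ)⁻¹) := by
    have := hNdiv.add tendsto_inv_atTop_zero
    rw [add_zero] at this
    refine this.congr fun t => ?_
    push_cast; ring
  have hle : ∀ t : ℝ, 0 < t → ((N t * m : ℕ) : ℝ) ≤ t := fun t ht => by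
    have := Nat.floor_le (mul_nonneg (inv_pos.2 hm').le ht.le)
    rw [le_inv_mul_iff₀ hm', mul_comm] at this
    exact_mod_cast this
  have hge : ∀ t : ℝ, t ≤ (((N t + 1) * m : ℕ) : ℝ) := fun t => by
    have := (Nat.lt_floor_add_one ((m : ℝ)⁻¹ * t)).le
    rw [inv_mul_le_iff₀ hm', mul_comm] at this
    exact_mod_cast this
  refine ⟨fun t => (s (N t) / N t - c) * (N t / t),
    fun t => s (N t + 1) / (N t + 1 : ℕ) * ((N t + 1 : ℕ) / t), ?_, ?_, ?_, ?_⟩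
  · filter_upwards [hNtop.eventually hlower, hNtop.eventually_gt_atTop 0, eventually_gt_atTop 0]
      with t h1 h2 h3
    have h2' : (N t : ℝ) ≠ 0 := Nat.cast_ne_zero.2 h2.ne'
    have heq : (s (N t) / N t - c) * (N t / t) = (s (N t) - N t * c) / t := by
      field_simp
    rw [heq]
    exact div_le_div_of_nonneg_right (h1.trans (hA (hle t h3))) h3.le
  · filter_upwards [eventually_gt_atTop 0] with t h3
    rw [div_mul_div_cancel₀ (Nat.cast_ne_zero.2 (Nat.succ_ne_zero _))]
    exact div_le_div_of_nonneg_right ((hA (hge t)).trans (hupper _)) h3.le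
  · rw [← sub_div, div_eq_mul_inv]
    exact ((hs.comp hNtop).sub_const c).mul hNdiv
  · rw [div_eq_mul_inv]
    exact (hs.comp ((tendsto_add_atTop_nat 1).comp hNtop)).mul hNdiv1

lemma exists_common_limit {φ : ℝ → ℝ} {a : ℕ → ℝ} {c : ℝ}
    (h : ∀ m : ℕ, 0 < m → ∃ L U : ℝ → ℝ, (∀ᶠ t in atTop, L t ≤ φ t) ∧ (∀ᶠ t in atTop, φ t ≤ U t) ∧
      Tendsto L atTop (𝓝 (a m - c / m)) ∧ Tendsto U atTop (𝓝 (a m))) :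
    ∃ H : ℝ, Tendsto a atTop (𝓝 H) ∧ Tendsto φ atTop (𝓝 H) := by
  have hcross : ∀ k m : ℕ, 0 < k → 0 < m → a k - c / k ≤ a m := by
    intro k m hk hm
    obtain ⟨L, -, hL, -, hL', -⟩ := h k hk
    obtain ⟨-, U, -, hU, -, hU'⟩ := h m hm
    refine le_of_tendsto_of_tendsto hL' hU' ?_
    filter_upwards [hL, hU] with t h1 h2 using h1.trans h2
  set H : ℝ := ⨅ m : ℕ, a (m + 1) with hH
  have hbdd : BddBelow (Set.range fun m : ℕ => a (m + 1)) :=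
    ⟨a 1 - c / (1 : ℕ), by rintro _ ⟨m, rfl⟩; exact hcross 1 (m + 1) one_pos m.succ_pos⟩
  have hHle : ∀ m : ℕ, 0 < m → H ≤ a m := by
    intro m hm
    obtain ⟨k, rfl⟩ := Nat.exists_eq_succ_of_ne_zero hm.ne'
    exact ciInf_le hbdd k
  have hleH : ∀ m : ℕ, 0 < m → a m - c / m ≤ H := fun m hm =>
    le_ciInf fun k => hcross m (k + 1) hm k.succ_pos
  have hc : Tendsto (fun m : ℕ => c / m) atTop (𝓝 0) := tendsto_const_div_atTop_nhds_zero_nat c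
  have ha : Tendsto a atTop (𝓝 H) := by
    refine tendsto_of_tendsto_of_tendsto_of_le_of_le' tendsto_const_nhds
      (by simpa using hc.const_add H) ?_ ?_
    · filter_upwards [eventually_gt_atTop 0] with m hm using hHle m hm
    · filter_upwards [eventually_gt_atTop 0] with m hm
      linarith [hleH m hm]
  refine ⟨H, ha, tendsto_order.2 ⟨fun b hb => ?_, fun b hb => ?_⟩⟩
  · have hlim : Tendsto (fun m : ℕ => a m - c / m) atTop (𝓝 H) := by simpa using ha.sub hc
    obtain ⟨m, hm, hm0⟩ := ((hlim.eventually_const_lt hb).and (eventually_gt_atTop 0)).exists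
    obtain ⟨L, -, hL, -, hL', -⟩ := h m hm0
    filter_upwards [hL, hL'.eventually_const_lt hm] with t h1 h2 using h2.trans_le h1
  · obtain ⟨m, hm, hm0⟩ := ((ha.eventually_lt_const hb).and (eventually_gt_atTop 0)).exists
    obtain ⟨-, U, -, hU, -, hU'⟩ := h m hm0
    filter_upwards [hU, hU'.eventually_lt_const hm] with t h1 h2 using h1.trans_lt h2

/-! ### The mass exponent -/

/-- Minus the logarithm in base `gold` of the mass of the interval of radius `gold ^ (-t)`
about `x`. -/
noncomputable def massExp (μ : Measure ℝ) (x t : ℝ) : ℝ :=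
  -Real.logb gold (μ.real (Set.Icc (x - gold ^ (-t)) (x + gold ^ (-t))))

lemma gold_rpow_neg_natCast (k : ℕ) : gold ^ (-(k : ℝ)) = gold⁻¹ ^ k := by
  rw [Real.rpow_neg gold_pos.le, Real.rpow_natCast, inv_pow]

lemma massExp_monotone {μ : Measure ℝ} [IsFiniteMeasure μ] {x : ℝ}
    (hx : ∀ k : ℕ, 0 < μ.real (Set.Icc (x - gold⁻¹ ^ k) (x + gold⁻¹ ^ k))) :
    Monotone (massExp μ x) := by
  have hmono : ∀ {t t' : ℝ}, t ≤ t' →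
      μ.real (Set.Icc (x - gold ^ (-t')) (x + gold ^ (-t')))
        ≤ μ.real (Set.Icc (x - gold ^ (-t)) (x + gold ^ (-t))) := by
    intro t t' htt'
    have := Real.rpow_le_rpow_of_exponent_le one_lt_gold.le (neg_le_neg htt')
    exact measureReal_mono (Set.Icc_subset_Icc (by linarith) (by linarith))
  intro t t' htt'
  refine neg_le_neg (Real.logb_le_logb_of_le one_lt_gold ?_ (hmono htt'))
  obtain ⟨k, hk⟩ := exists_nat_ge t'
  refine (hx k).trans_le ?_
  rw [← gold_rpow_neg_natCast]
  exact hmono hk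

lemma measurable_measureReal_Icc (μ : Measure ℝ) [SFinite μ] (r : ℝ) :
    Measurable fun x => μ.real (Set.Icc (x - r) (x + r)) := by
  have hs : MeasurableSet ({q : ℝ × ℝ | q.1 - r ≤ q.2} ∩ {q : ℝ × ℝ | q.2 ≤ q.1 + r}) :=
    (measurableSet_le (by fun_prop) (by fun_prop)).inter
      (measurableSet_le (by fun_prop) (by fun_prop))
  exact (measurable_measure_prodMk_left hs).ennreal_toReal

lemma measurable_massExp (μ : Measure ℝ) [SFinite μ] (t : ℝ) :
    Measurable fun x => massExp μ x t := by
  unfold massExp Real.logb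
  exact ((Real.measurable_log.comp (measurable_measureReal_Icc μ _)).div_const _).neg

lemma tendsto_log_mass_div_log {μ : Measure ℝ} [IsFiniteMeasure μ] {x H : ℝ}
    (hx : ∀ k : ℕ, 0 < μ.real (Set.Icc (x - gold⁻¹ ^ k) (x + gold⁻¹ ^ k)))
    (hlim : Tendsto (fun n : ℕ => massExp μ x n / n) atTop (𝓝 H)) :
    Tendsto (fun r : ℝ => Real.log (μ (Set.Icc (x - r) (x + r))).toReal / Real.log r)
      (𝓝[>] 0) (𝓝 H) := by
  obtain ⟨L, U, hL, hU, hL', hU'⟩ := exists_bounds_of_monotone (massExp_monotone hx)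
    (s := fun n => massExp μ x n) (c := 0) one_pos (fun n => by simp) (by simp) hlim
  have ht : Tendsto (fun t => massExp μ x t / t) atTop (𝓝 H) :=
    tendsto_of_tendsto_of_tendsto_of_le_of_le' (by simpa using hL') (by simpa using hU') hL hU
  have hr : Tendsto (fun r => -Real.logb gold r) (𝓝[>] 0) atTop :=
    tendsto_neg_atBot_atTop.comp (Real.tendsto_logb_nhdsGT_zero one_lt_gold)
  refine (ht.comp hr).congr' ?_
  filter_upwards [self_mem_nhdsWithin] with r hr0
  have hlog : Real.log gold ≠ 0 := (Real.log_pos one_lt_gold).ne'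
  rw [Function.comp_apply, massExp, neg_neg,
    Real.rpow_logb gold_pos one_lt_gold.ne' hr0, neg_div_neg_eq, Real.logb, Real.logb,
    div_div_div_cancel_right₀ hlog, measureReal_def]

namespace IsCoinMeasure

variable {p : Measure (ℕ → Bool)}

lemma measureReal_Icc_piMap_pos (hp : IsCoinMeasure p) (ε : ℕ → Bool) (k : ℕ) :
    0 < (erdosOf p).real (Set.Icc (piMap ε - gold⁻¹ ^ k) (piMap ε + gold⁻¹ ^ k)) := by
  have h := hp.prod_wordProb_le 1 k ε
  rw [mul_one] at h
  exact (Finset.prod_pos fun j _ => wordProb_pos _).trans_le h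

lemma ae_exists_limit (hp : IsCoinMeasure p) :
    ∀ᵐ ε ∂p, ∃ H : ℝ, Tendsto (fun n : ℕ => Hent n / n) atTop (𝓝 H) ∧
    Tendsto (fun t : ℝ => massExp (erdosOf p) (piMap ε) t / t) atTop (𝓝 H) := by
  have := hp.isProbabilityMeasure_erdosOf
  filter_upwards [ae_all_iff.2 hp.ae_eventually_mass_le, ae_all_iff.2 hp.ae_tendsto_sum_info]
    with ε hmass hinfo
  refine exists_common_limit (c := Real.logb gold 58) fun m hm => ?_
  have hprod : ∀ n : ℕ, -Real.logb gold (∏ j : Fin n, wordProb (block m j ε))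
      = ∑ j ∈ Finset.range n, -Real.logb gold (wordProb (block m j ε)) := fun n => by
    rw [Real.logb_prod _ _ fun j _ => (wordProb_pos _).ne', Finset.sum_range, Finset.sum_neg_distrib]
  have hpos : ∀ n : ℕ, 0 < ∏ j : Fin n, wordProb (block m j ε) := fun n =>
    Finset.prod_pos fun j _ => wordProb_pos _
  refine exists_bounds_of_monotone (massExp_monotone (hp.measureReal_Icc_piMap_pos ε)) hm
    (fun n => ?_) ?_ (hinfo m)
  · rw [← hprod, massExp, gold_rpow_neg_natCast]
    exact neg_le_neg (Real.logb_le_logb_of_le one_lt_gold (hpos n) (hp.prod_wordProb_le m n ε))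
  · filter_upwards [hmass m] with n hn
    have h := Real.logb_le_logb_of_le one_lt_gold (hp.measureReal_Icc_piMap_pos ε _) hn
    rw [Real.logb_mul (by positivity) (hpos n).ne', Real.logb_pow] at h
    rw [← hprod, massExp, gold_rpow_neg_natCast]
    linarith

end IsCoinMeasure

/-- The pointwise dimension of the Erdős measure equals Garsia's entropy `H_μ`:
the limit `H_μ = lim H⁽ⁿ⁾/n` exists, and for μ-a.e. `x ∈ [0,1]`,
`log μ([x−r, x+r]) / log r → H_μ` as `r → 0⁺`. -/
theorem erdos_pointwise_dimension (p : Measure (ℕ → Bool)) (hp : IsCoinMeasure p) :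
    ∃ H : ℝ, Tendsto (fun n : ℕ => Hent n / n) atTop (nhds H) ∧
      ∀ᵐ x ∂(erdosOf p), x ∈ Set.Icc (0 : ℝ) 1 →
        Tendsto
          (fun r : ℝ =>
            Real.log ((erdosOf p) (Set.Icc (x - r) (x + r))).toReal / Real.log r)
          (nhdsWithin 0 (Set.Ioi 0)) (nhds H) := by
  have := hp.isProbabilityMeasure
  have := hp.isProbabilityMeasure_erdosOf
  obtain ⟨-, H, hH, -⟩ := hp.ae_exists_limit.exists
  refine ⟨H, hH, ?_⟩
  have hae : ∀ᵐ x ∂(erdosOf p),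
      (∀ k : ℕ, 0 < (erdosOf p).real (Set.Icc (x - gold⁻¹ ^ k) (x + gold⁻¹ ^ k))) ∧
        Tendsto (fun n : ℕ => massExp (erdosOf p) x n / n) atTop (𝓝 H) := by
    rw [erdosOf, ae_map_iff measurable_piMap.aemeasurable]
    · filter_upwards [hp.ae_exists_limit] with ε hε
      obtain ⟨H', hH', hlim⟩ := hε
      rw [tendsto_nhds_unique hH hH']
      exact ⟨hp.measureReal_Icc_piMap_pos ε, hlim.comp tendsto_natCast_atTop_atTop⟩
    · refine MeasurableSet.inter (s₁ := {x | ∀ k : ℕ, 0 < (erdosOf p).real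
        (Set.Icc (x - gold⁻¹ ^ k) (x + gold⁻¹ ^ k))}) ?_ ?_
      · simp only [Set.ofPred_forall]
        exact MeasurableSet.iInter fun k =>
          measurableSet_lt measurable_const (measurable_measureReal_Icc _ _)
      · exact measurableSet_tendsto _ fun n : ℕ =>
          (measurable_massExp (erdosOf p) n).div_const (n : ℝ)
  filter_upwards [hae] with x hx _
  exact tendsto_log_mass_div_log hx.1 hx.2
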